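/- Let n ≥ 1 and let f : ℝ^{n+1} → ℝ be bounded, of class C², and compactly supported, and let u(t,x) = ∫₀^∞ ∫_{ℝⁿ} W(τ,y) f(t−τ, x−y) dy dτ. Then for every (t,x) ∈ ℝ^{n+1} one has ∂_t u(t,x) = lim_{ε→0} ∬_{Ω_ε} ∂_τ W(τ,y) f(t−τ, x−y) dy dτ + B_n f(t,x). -/

import Mathlib

open MeasureTheory Filter Set Metric
open scoped ENNReal NNReal Topology

noncomputable section

abbrev En (n : ℕ) := EuclideanSpace ℝ (Fin n)

/-- The Gauss–Weierstrass kernel `W(τ,y) = (4πτ)^{-n/2} exp(-|y|²/(4τ))`, extended by `0`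
for `τ ≤ 0`. -/
def W (n : ℕ) (τ : ℝ) (y : En n) : ℝ :=
  if 0 < τ then (4 * Real.pi * τ) ^ (-(n : ℝ) / 2) * Real.exp (-‖y‖ ^ 2 / (4 * τ)) else 0

/-- Partial derivative of `g : ℝⁿ → ℝ` in the `i`-th coordinate direction. -/
def pd {n : ℕ} (i : Fin n) (g : En n → ℝ) (y : En n) : ℝ :=
  fderiv ℝ g y (EuclideanSpace.single i 1)

/-- Laplacian of `g : ℝⁿ → ℝ`. -/
def lap {n : ℕ} (g : En n → ℝ) (x : En n) : ℝ :=
  ∑ i : Fin n, pd i (pd i g) x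

/-- `∂_{y_i y_j} W(τ, ·)`. -/
def Wij (n : ℕ) (i j : Fin n) (τ : ℝ) (y : En n) : ℝ :=
  pd i (pd j (W n τ)) y

/-- `∂_τ W(·, y)`. -/
def Wt (n : ℕ) (τ : ℝ) (y : En n) : ℝ :=
  deriv (fun σ => W n σ y) τ

/-- The truncation region `Ω_ε = {(τ,y) : max(|τ|^{1/2}, |y|) > ε}`. -/
def Omega (n : ℕ) (ε : ℝ) : Set (ℝ × En n) :=
  {p | ε < max (Real.sqrt |p.1|) ‖p.2‖}

/-- `A_n = (1/(n Γ(n/2))) ∫_{1/4}^∞ u^{n/2-1} e^{-u} du`. -/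
def An (n : ℕ) : ℝ :=
  (1 / (n * Real.Gamma ((n : ℝ) / 2))) *
    ∫ u in Set.Ioi (1 / 4 : ℝ), u ^ ((n : ℝ) / 2 - 1) * Real.exp (-u)

/-- `B_n = (1/Γ(n/2)) ∫_0^{1/4} u^{n/2-1} e^{-u} du`. -/
def Bn (n : ℕ) : ℝ :=
  (1 / Real.Gamma ((n : ℝ) / 2)) *
    ∫ u in Set.Ioo (0 : ℝ) (1 / 4 : ℝ), u ^ ((n : ℝ) / 2 - 1) * Real.exp (-u)

variable {n : ℕ}

lemma W_of_pos {τ : ℝ} (hτ : 0 < τ) (y : En n) :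
    W n τ y = (4 * Real.pi * τ) ^ (-(n : ℝ) / 2) * Real.exp (-‖y‖ ^ 2 / (4 * τ)) :=
  if_pos hτ

lemma W_of_nonpos {τ : ℝ} (hτ : τ ≤ 0) (y : En n) : W n τ y = 0 :=
  if_neg hτ.not_gt

lemma W_nonneg (τ : ℝ) (y : En n) : 0 ≤ W n τ y := by
  unfold W
  split_ifs <;> positivity

/-- The closed form of `∂_τ W`, valid for `τ ≠ 0`. -/
def heatKernelTimeDeriv (n : ℕ) (τ : ℝ) (y : En n) : ℝ :=
  (‖y‖ ^ 2 / 4 - n / 2 * τ) / τ ^ 2 * W n τ y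

lemma hasDerivAt_W {τ : ℝ} (hτ : 0 < τ) (y : En n) :
    HasDerivAt (fun σ => W n σ y) (heatKernelTimeDeriv n τ y) τ := by
  have hbase : HasDerivAt (fun σ : ℝ => 4 * Real.pi * σ) (4 * Real.pi) τ := by
    simpa using (hasDerivAt_id τ).const_mul (4 * Real.pi)
  have hpow := hbase.rpow_const (p := -(n : ℝ) / 2) (Or.inl (by positivity))
  have hexp : HasDerivAt (fun σ : ℝ => Real.exp (-‖y‖ ^ 2 / (4 * σ)))
      (Real.exp (-‖y‖ ^ 2 / (4 * τ)) * (‖y‖ ^ 2 / (4 * τ ^ 2))) τ := by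
    have h4 : HasDerivAt (fun σ : ℝ => 4 * σ) 4 τ := by
      simpa using (hasDerivAt_id τ).const_mul (4 : ℝ)
    refine ((hasDerivAt_const τ (-‖y‖ ^ 2)).fun_div h4 (by positivity)).exp.congr_deriv ?_
    field_simp
    ring
  have hprod := hpow.mul hexp
  refine (hprod.congr_of_eventuallyEq (f₁ := fun σ => W n σ y) ?_).congr_deriv ?_
  · filter_upwards [lt_mem_nhds hτ] with σ hσ
    exact W_of_pos hσ y
  · rw [heatKernelTimeDeriv, W_of_pos hτ, Real.rpow_sub_one (by positivity)]
    field_simp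
    ring

lemma Wt_eq_heatKernelTimeDeriv {τ : ℝ} (hτ : τ ≠ 0) (y : En n) :
    Wt n τ y = heatKernelTimeDeriv n τ y := by
  rcases hτ.lt_or_gt with h | h
  · have hW : (fun σ => W n σ y) =ᶠ[𝓝 τ] fun _ => 0 := by
      filter_upwards [gt_mem_nhds h] with σ hσ
      exact W_of_nonpos hσ.le y
    rw [Wt, hW.deriv_eq, deriv_const, heatKernelTimeDeriv, W_of_nonpos h.le, mul_zero]
  · exact (hasDerivAt_W h y).deriv

lemma measurable_W : Measurable fun p : ℝ × En n => W n p.1 p.2 := by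
  unfold W
  refine Measurable.ite (measurableSet_lt measurable_const measurable_fst) ?_ measurable_const
  fun_prop

lemma measurable_heatKernelTimeDeriv :
    Measurable fun p : ℝ × En n => heatKernelTimeDeriv n p.1 p.2 := by
  unfold heatKernelTimeDeriv
  exact Measurable.mul (by fun_prop) measurable_W

lemma integral_W {τ : ℝ} (hτ : 0 < τ) : ∫ y : En n, W n τ y = 1 := by
  have h := GaussianFourier.integral_rexp_neg_mul_sq_norm (V := En n) (b := 1 / (4 * τ))
    (by positivity)
  have he : ∀ y : En n, -‖y‖ ^ 2 / (4 * τ) = -(1 / (4 * τ)) * ‖y‖ ^ 2 := fun y => by ring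
  simp_rw [W_of_pos hτ, integral_const_mul, he]
  rw [h, finrank_euclideanSpace_fin, neg_div, Real.rpow_neg (by positivity),
    show Real.pi / (1 / (4 * τ)) = 4 * Real.pi * τ by field_simp]
  exact inv_mul_cancel₀ (by positivity)

lemma integrable_W (τ : ℝ) : Integrable fun y : En n => W n τ y := by
  rcases le_or_gt τ 0 with h | h
  · simp [W_of_nonpos h]
  · by_contra hc
    simpa [integral_W h] using integral_undef hc

lemma locallyIntegrable_W : LocallyIntegrable fun p : ℝ × En n => W n p.1 p.2 := by
  intro p
  refine ⟨Ioo (p.1 - 1) (p.1 + 1) ×ˢ univ,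
    prod_mem_nhds (Ioo_mem_nhds (by linarith) (by linarith)) univ_mem, ?_⟩
  rw [IntegrableOn, Measure.volume_eq_prod, ← Measure.prod_restrict, Measure.restrict_univ,
    integrable_prod_iff measurable_W.aestronglyMeasurable]
  refine ⟨.of_forall integrable_W, ?_⟩
  refine Measure.integrableOn_of_bounded (M := 1) (by simp) ?_ (.of_forall fun τ => ?_)
  · exact (measurable_W.norm.stronglyMeasurable.integral_prod_right').aestronglyMeasurable
  · simp_rw [Real.norm_of_nonneg (W_nonneg τ _)]
    rcases le_or_gt τ 0 with h | h
    · simp [W_of_nonpos h]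
    · simp [integral_W h]

/-- Away from the origin, the heat kernel vanishes to second order at `τ = 0`. -/
lemma exists_W_le_mul_sq {ε T : ℝ} (hε : 0 < ε) (hT : 0 < T) :
    ∃ C, 0 ≤ C ∧ ∀ p ∈ Omega n ε, 0 < p.1 → p.1 ≤ T → W n p.1 p.2 ≤ C * p.1 ^ 2 := by
  obtain ⟨m, hm⟩ : ∃ m : ℕ, (n : ℝ) / 2 + 2 ≤ m := exists_nat_ge _
  set c : ℝ := (4 * Real.pi) ^ (-(n : ℝ) / 2) with hc_def
  have hc : 0 < c := by positivity
  set C₁ : ℝ := c * (ε ^ 2) ^ (-(n : ℝ) / 2 - 2)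
  set C₂ : ℝ := c * (m.factorial * (4 / ε ^ 2) ^ m * T ^ ((m : ℝ) - n / 2 - 2))
  have hC₁ : 0 ≤ C₁ := by positivity
  have hC₂ : 0 ≤ C₂ := by positivity
  refine ⟨C₁ + C₂, by positivity, ?_⟩
  rintro ⟨τ, y⟩ hp hτ hτT
  simp only at hτ hτT ⊢
  have hW : W n τ y
      = c * (τ ^ (-(n : ℝ) / 2 - 2) * Real.exp (-‖y‖ ^ 2 / (4 * τ))) * τ ^ 2 := by
    rw [W_of_pos hτ, Real.mul_rpow (by positivity) hτ.le, Real.rpow_sub hτ, Real.rpow_ofNat, ← hc_def]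
    field_simp
  rw [hW]
  gcongr
  have hmax : ε < Real.sqrt |τ| ∨ ε < ‖y‖ := lt_max_iff.mp hp
  rcases hmax with h | h
  · have hετ : ε ^ 2 ≤ τ := by
      rw [abs_of_pos hτ] at h
      exact ((Real.lt_sqrt hε.le).mp h).le
    have h1 : τ ^ (-(n : ℝ) / 2 - 2) ≤ (ε ^ 2) ^ (-(n : ℝ) / 2 - 2) :=
      Real.rpow_le_rpow_of_nonpos (by positivity) hετ
        (by have : (0 : ℝ) ≤ n := n.cast_nonneg
            linarith)
    have h2 : Real.exp (-‖y‖ ^ 2 / (4 * τ)) ≤ 1 := by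
      rw [Real.exp_le_one_iff, neg_div]
      exact neg_nonpos.mpr (by positivity)
    calc c * (τ ^ (-(n : ℝ) / 2 - 2) * Real.exp (-‖y‖ ^ 2 / (4 * τ)))
        ≤ c * ((ε ^ 2) ^ (-(n : ℝ) / 2 - 2) * 1) := by gcongr
      _ = C₁ := by rw [mul_one]
      _ ≤ C₁ + C₂ := by linarith
  · have hexp : Real.exp (-‖y‖ ^ 2 / (4 * τ)) ≤ m.factorial * (4 / ε ^ 2) ^ m * τ ^ (m : ℝ) := by
      have h1 : Real.exp (-‖y‖ ^ 2 / (4 * τ)) ≤ Real.exp (-(ε ^ 2 / (4 * τ))) := by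
        rw [neg_div]
        gcongr
      have h2 := Real.pow_div_factorial_le_exp (ε ^ 2 / (4 * τ)) (by positivity) m
      refine h1.trans ?_
      rw [Real.exp_neg]
      refine (inv_anti₀ (by positivity) h2).trans_eq ?_
      rw [Real.rpow_natCast]
      simp only [div_pow, mul_pow]
      field_simp
    calc c * (τ ^ (-(n : ℝ) / 2 - 2) * Real.exp (-‖y‖ ^ 2 / (4 * τ)))
        ≤ c * (τ ^ (-(n : ℝ) / 2 - 2) * (m.factorial * (4 / ε ^ 2) ^ m * τ ^ (m : ℝ))) := by
          gcongr
      _ = c * (m.factorial * (4 / ε ^ 2) ^ m * τ ^ ((m : ℝ) - n / 2 - 2)) := by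
          rw [show (m : ℝ) - n / 2 - 2 = (-(n : ℝ) / 2 - 2) + m by ring, Real.rpow_add hτ]
          ring
      _ ≤ C₂ := by
          have hle : τ ^ ((m : ℝ) - n / 2 - 2) ≤ T ^ ((m : ℝ) - n / 2 - 2) :=
            Real.rpow_le_rpow hτ.le hτT (by linarith)
          exact mul_le_mul_of_nonneg_left
            (mul_le_mul_of_nonneg_left hle (by positivity)) hc.le
      _ ≤ C₁ + C₂ := by linarith

lemma isOpen_Omega (ε : ℝ) : IsOpen (Omega n ε) :=
  isOpen_lt continuous_const (by fun_prop)

lemma ae_fst_ne_zero : ∀ᵐ p : ℝ × En n, p.1 ≠ 0 :=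
  Measure.quasiMeasurePreserving_fst.ae (Measure.ae_ne volume (0 : ℝ))

lemma integral_closedBall_W_one (hn : 1 ≤ n) :
    ∫ z in closedBall (0 : En n) 1, W n 1 z = Bn n := by
  have : Nonempty (Fin n) := ⟨⟨0, hn⟩⟩
  have hn0 : (0 : ℝ) < n := by exact_mod_cast hn
  set c : ℝ := (4 * Real.pi) ^ (-(n : ℝ) / 2) with hc_def
  set φ : ℝ → ℝ := (Iic 1).indicator fun r => c * Real.exp (-r ^ 2 / 4)
  have h1 : ∫ z in closedBall (0 : En n) 1, W n 1 z = ∫ z : En n, φ ‖z‖ := by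
    rw [← integral_indicator measurableSet_closedBall]
    refine integral_congr_ae (.of_forall fun z => ?_)
    simp only [φ, indicator, mem_closedBall_zero_iff, mem_Iic, W_of_pos one_pos, mul_one, c]
  set g : ℝ → ℝ := (Iic (1 / 4)).indicator fun u => u ^ ((n : ℝ) / 2 - 1) * Real.exp (-u)
  have h2 : Bn n = (1 / Real.Gamma ((n : ℝ) / 2)) * ∫ u in Ioi (0 : ℝ), g u := by
    rw [Bn, ← integral_Ioc_eq_integral_Ioo, setIntegral_indicator measurableSet_Iic,
      Ioi_inter_Iic]
  have h3 : ∫ u in Ioi (0 : ℝ), g u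
      = (1 / 4) * ∫ r in Ioi (0 : ℝ), 2 * r * g (1 / 4 * r ^ 2) := by
    have hscale := integral_comp_mul_left_Ioi g 0 (b := 1 / 4) (by norm_num)
    have hpow := integral_comp_rpow_Ioi_of_pos (g := fun u => g (1 / 4 * u)) (p := 2) two_pos
    simp only [mul_zero, smul_eq_mul] at hscale hpow
    have hpow' : ∫ r in Ioi (0 : ℝ), 2 * r * g (1 / 4 * r ^ 2)
        = ∫ u in Ioi (0 : ℝ), g (1 / 4 * u) := by
      rw [← hpow]
      norm_num
    rw [hpow', hscale]
    ring
  have h4 : ∀ r ∈ Ioi (0 : ℝ), r ^ (n - 1) • φ r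
      = c * 4 ^ ((n : ℝ) / 2) / 8 * (2 * r * g (1 / 4 * r ^ 2)) := by
    intro r hr
    have hr0 : 0 < r := hr
    rcases le_or_gt r 1 with hr1 | hr1
    · have hmem : 1 / 4 * r ^ 2 ≤ 1 / 4 := by nlinarith
      have hpow : (1 / 4 * r ^ 2) ^ ((n : ℝ) / 2 - 1)
          = 4 * (4 ^ ((n : ℝ) / 2))⁻¹ * (r ^ (n - 1) / r) := by
        rw [Real.mul_rpow (by norm_num) (by positivity), ← Real.rpow_natCast r 2,
          ← Real.rpow_mul hr0.le, one_div, Real.inv_rpow (by norm_num),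
          Real.rpow_sub_one (by norm_num), show ((2 : ℕ) : ℝ) * ((n : ℝ) / 2 - 1) = (n - 1 : ℕ) - 1 by
            push_cast [Nat.cast_sub hn]; ring,
          Real.rpow_sub_one hr0.ne', Real.rpow_natCast]
        field_simp
      simp only [φ, g, indicator, mem_Iic, hr1, hmem, if_true, hpow, smul_eq_mul]
      rw [show -(1 / 4 * r ^ 2) = -r ^ 2 / 4 by ring]
      field_simp
      ring
    · have hmem : ¬ 1 / 4 * r ^ 2 ≤ 1 / 4 := by nlinarith
      simp only [φ, g, indicator, mem_Iic, hr1.not_ge, hmem, if_false, smul_zero, mul_zero]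
  have hvol : volume.real (ball (0 : En n) 1)
      = Real.pi ^ ((n : ℝ) / 2) / (n / 2 * Real.Gamma ((n : ℝ) / 2)) := by
    rw [measureReal_def, EuclideanSpace.volume_ball, Fintype.card_fin, ENNReal.ofReal_one,
      one_pow, one_mul, Real.Gamma_add_one (by positivity), ENNReal.toReal_ofReal (by positivity),
      Real.sqrt_eq_rpow, ← Real.rpow_natCast, ← Real.rpow_mul Real.pi_pos.le, one_div_mul_eq_div]
  have hΓ : 0 < Real.Gamma ((n : ℝ) / 2) := Real.Gamma_pos_of_pos (by positivity)
  have hc : c = (4 ^ ((n : ℝ) / 2) * Real.pi ^ ((n : ℝ) / 2))⁻¹ := by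
    rw [hc_def, neg_div, Real.rpow_neg (by positivity), Real.mul_rpow (by norm_num) (by positivity)]
  rw [h1, integral_fun_norm_addHaar, finrank_euclideanSpace_fin,
    setIntegral_congr_fun measurableSet_Ioi h4, integral_const_mul, hvol, h2, h3, hc,
    nsmul_eq_mul, smul_eq_mul]
  field_simp
  norm_num

lemma tendsto_integral_closedBall_W (hn : 1 ≤ n) {g : ℝ × En n → ℝ} (hg : Continuous g)
    {M : ℝ} (hM : ∀ p, |g p| ≤ M) :
    Tendsto (fun ε : ℝ => ∫ y in closedBall (0 : En n) ε, W n (ε ^ 2) y * g (ε ^ 2, y))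
      (𝓝[>] 0) (𝓝 (Bn n * g 0)) := by
  have hscale : ∀ ε : ℝ, 0 < ε →
      ∫ y in closedBall (0 : En n) ε, W n (ε ^ 2) y * g (ε ^ 2, y)
        = ∫ z in closedBall (0 : En n) 1, W n 1 z * g (ε ^ 2, ε • z) := by
    intro ε hε
    have h := Measure.setIntegral_comp_smul_of_pos (volume : Measure (En n))
      (fun y => W n (ε ^ 2) y * g (ε ^ 2, y)) (closedBall 0 1) hε
    rw [smul_unitClosedBall_of_nonneg hε.le, finrank_euclideanSpace_fin, smul_eq_mul] at h
    have hker : ∀ z : En n, W n (ε ^ 2) (ε • z) = (ε ^ n)⁻¹ * W n 1 z := by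
      intro z
      rw [W_of_pos (by positivity), W_of_pos one_pos, Real.mul_rpow (by positivity) (by positivity),
        ← Real.rpow_natCast ε 2, ← Real.rpow_mul hε.le, norm_smul, Real.norm_of_nonneg hε.le,
        show ((2 : ℕ) : ℝ) * (-(n : ℝ) / 2) = -n by push_cast; ring, Real.rpow_neg hε.le,
        Real.rpow_natCast, Real.rpow_natCast, mul_one, mul_one,
        show -(ε * ‖z‖) ^ 2 / (4 * ε ^ 2) = -‖z‖ ^ 2 / 4 by field_simp]
      ring
    simp_rw [hker, mul_assoc, integral_const_mul] at h
    exact (mul_left_cancel₀ (by positivity) h).symm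
  rw [← integral_closedBall_W_one hn, ← integral_mul_const]
  refine Tendsto.congr' (f₁ := fun ε : ℝ =>
    ∫ z in closedBall (0 : En n) 1, W n 1 z * g (ε ^ 2, ε • z)) ?_ ?_
  · filter_upwards [self_mem_nhdsWithin] with ε hε using (hscale ε hε).symm
  have hmeas : Measurable fun z : En n => W n 1 z := measurable_W.comp measurable_prodMk_left
  refine tendsto_integral_filter_of_dominated_convergence (fun z => W n 1 z * M) ?_ ?_ ?_ ?_
  · refine .of_forall fun ε => ?_
    exact (hmeas.mul (hg.comp (by fun_prop)).measurable).aestronglyMeasurable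
  · refine .of_forall fun ε => .of_forall fun z => ?_
    rw [norm_mul, Real.norm_of_nonneg (W_nonneg 1 z)]
    exact mul_le_mul_of_nonneg_left (hM _) (W_nonneg 1 z)
  · exact ((integrable_W 1).mul_const M).integrableOn
  · refine .of_forall fun z => ?_
    have hcont : Continuous fun ε : ℝ => W n 1 z * g (ε ^ 2, ε • z) :=
      continuous_const.mul (hg.comp (by fun_prop))
    have := (hcont.tendsto 0).mono_left (nhdsWithin_le_nhds (s := Ioi (0 : ℝ)))
    simpa [Prod.zero_eq_mk] using this

/-- Slices of `Ω_ε ∩ {τ > 0}` at fixed `y` are half-lines. -/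
lemma mem_Omega_and_pos_iff {ε : ℝ} (hε : 0 < ε) (τ : ℝ) (y : En n) :
    (τ, y) ∈ Omega n ε ∩ {p | 0 < p.1} ↔ τ ∈ Ioi (if ‖y‖ ≤ ε then ε ^ 2 else 0) := by
  simp only [Omega, mem_inter_iff, mem_ofPred_eq, lt_max_iff, mem_Ioi]
  split_ifs with h
  · simp only [h.not_gt, or_false]
    constructor
    · rintro ⟨h1, h2⟩
      rwa [abs_of_pos h2, Real.lt_sqrt hε.le] at h1
    · intro h1
      have h2 : 0 < τ := (by positivity : 0 < ε ^ 2).trans h1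
      exact ⟨by rwa [abs_of_pos h2, Real.lt_sqrt hε.le], h2⟩
  · simp [not_le.mp h]

lemma tendsto_setIntegral_Omega {F : ℝ × En n → ℝ} (hF : Integrable F) :
    Tendsto (fun ε : ℝ => ∫ p in Omega n ε, F p) (𝓝[>] 0) (𝓝 (∫ p, F p)) := by
  simp_rw [fun ε : ℝ => (integral_indicator (f := F) (μ := volume)
    (isOpen_Omega (n := n) ε).measurableSet).symm]
  refine tendsto_integral_filter_of_dominated_convergence (fun p => ‖F p‖) ?_ ?_ hF.norm ?_
  · exact .of_forall fun ε =>
      hF.aestronglyMeasurable.indicator (isOpen_Omega ε).measurableSet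
  · exact .of_forall fun ε => .of_forall fun p => norm_indicator_le_norm_self F p
  · filter_upwards [ae_fst_ne_zero] with p hp
    refine tendsto_const_nhds.congr' ?_
    have hpos : 0 < Real.sqrt |p.1| := Real.sqrt_pos.mpr (abs_pos.mpr hp)
    filter_upwards [Ioo_mem_nhdsGT hpos] with ε hε
    have hmem : p ∈ Omega n ε := lt_max_of_lt_left hε.2
    exact (indicator_of_mem hmem F).symm

lemma deriv_heat_potential {f : ℝ × En n → ℝ} (hf : ContDiff ℝ 1 f) (hfc : HasCompactSupport f)
    (t : ℝ) (x : En n) :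
    deriv (fun s : ℝ => ∫ p : ℝ × En n, W n p.1 p.2 * f (s - p.1, x - p.2)) t
      = ∫ p : ℝ × En n, W n p.1 p.2 * fderiv ℝ f (t - p.1, x - p.2) (1, 0) := by
  have : (volume : Measure (ℝ × En n)).IsAddLeftInvariant := by
    rw [Measure.volume_eq_prod]
    infer_instance
  have h := hfc.hasFDerivAt_convolution_right (μ := volume) (ContinuousLinearMap.mul ℝ ℝ)
    (locallyIntegrable_W (n := n)) hf (t, x)
  have hline : HasDerivAt (fun s : ℝ => (s, x)) ((1 : ℝ), (0 : En n)) t :=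
    (hasDerivAt_id t).prodMk (hasDerivAt_const t x)
  have hcomp := h.comp_hasDerivAt t hline
  rw [convolution_precompR_apply _ locallyIntegrable_W (hfc.fderiv ℝ)
    (hf.continuous_fderiv one_ne_zero)] at hcomp
  exact hcomp.deriv

lemma integrable_W_mul {g : ℝ × En n → ℝ} (hg : Continuous g) (hgc : HasCompactSupport g) :
    Integrable fun p : ℝ × En n => W n p.1 p.2 * g p :=
  locallyIntegrable_W.integrable_smul_right_of_hasCompactSupport hg hgc

lemma integrableOn_heatKernelTimeDeriv_mul {ε : ℝ} (hε : 0 < ε) {g : ℝ × En n → ℝ}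
    (hg : Continuous g) (hgc : HasCompactSupport g) :
    IntegrableOn (fun p : ℝ × En n => heatKernelTimeDeriv n p.1 p.2 * g p)
      (Omega n ε ∩ {p | 0 < p.1}) := by
  obtain ⟨M, hM⟩ := hg.bounded_above_of_compact_support hgc
  obtain ⟨R, hR, hsupp⟩ := hgc.isCompact.isBounded.subset_closedBall_lt 0 0
  obtain ⟨C, hC, hWC⟩ := exists_W_le_mul_sq (n := n) hε hR
  have hmeas : Measurable fun p : ℝ × En n => heatKernelTimeDeriv n p.1 p.2 * g p :=
    measurable_heatKernelTimeDeriv.mul hg.measurable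
  have hD : MeasurableSet (Omega n ε ∩ {p : ℝ × En n | 0 < p.1}) :=
    (isOpen_Omega ε).measurableSet.inter (measurableSet_lt measurable_const measurable_fst)
  have hS : IntegrableOn (fun p : ℝ × En n => heatKernelTimeDeriv n p.1 p.2 * g p)
      (Omega n ε ∩ {p | 0 < p.1} ∩ tsupport g) := by
    refine Measure.integrableOn_of_bounded (M := (R ^ 2 / 4 + n / 2 * R) * C * M)
      (measure_ne_top_of_subset inter_subset_right hgc.isCompact.measure_ne_top)
      hmeas.aestronglyMeasurable ?_
    refine ae_restrict_of_forall_mem (hD.inter (isClosed_tsupport g).measurableSet) ?_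
    rintro ⟨τ, y⟩ ⟨⟨hp, hτ⟩, hps⟩
    replace hτ : 0 < τ := hτ
    have hnorm : max ‖τ‖ ‖y‖ ≤ R := mem_closedBall_zero_iff.mp (hsupp hps)
    have hτR : τ ≤ R := (le_abs_self τ).trans ((le_max_left _ _).trans hnorm)
    have hyR : ‖y‖ ≤ R := (le_max_right _ _).trans hnorm
    rw [norm_mul]
    refine mul_le_mul ?_ (hM _) (norm_nonneg _) (by positivity)
    rw [heatKernelTimeDeriv, norm_mul, Real.norm_of_nonneg (W_nonneg τ y), norm_div,
      Real.norm_of_nonneg (sq_nonneg τ), div_mul_eq_mul_div, div_le_iff₀ (by positivity), mul_assoc]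
    refine mul_le_mul ?_ (hWC (τ, y) hp hτ hτR) (W_nonneg τ y) (by positivity)
    calc ‖‖y‖ ^ 2 / 4 - n / 2 * τ‖ ≤ ‖‖y‖ ^ 2 / 4‖ + ‖(n : ℝ) / 2 * τ‖ := norm_sub_le _ _
      _ = ‖y‖ ^ 2 / 4 + n / 2 * τ := by
          rw [Real.norm_of_nonneg (by positivity), Real.norm_of_nonneg (by positivity)]
      _ ≤ R ^ 2 / 4 + n / 2 * R := by gcongr
  refine hS.of_forall_sdiff_eq_zero hD ?_
  rintro p ⟨hpD, hpS⟩
  rw [image_eq_zero_of_notMem_tsupport fun h => hpS ⟨hpD, h⟩, mul_zero]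

lemma integral_Ioi_heatKernel_ibp {a : ℝ} (ha : 0 ≤ a) {y : En n} (hay : 0 < a ∨ y ≠ 0)
    {φ φ' : ℝ → ℝ} (hφ : ∀ τ, HasDerivAt φ (φ' τ) τ) (hφ0 : φ =ᶠ[atTop] 0)
    (hint : IntegrableOn (fun τ => heatKernelTimeDeriv n τ y * φ τ + W n τ y * φ' τ) (Ioi a)) :
    ∫ τ in Ioi a, (heatKernelTimeDeriv n τ y * φ τ + W n τ y * φ' τ) = -(W n a y * φ a) := by
  have hcontW : ContinuousWithinAt (fun τ => W n τ y) (Ici a) a := by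
    rcases ha.eq_or_lt with rfl | ha
    · have hy : 0 < ‖y‖ := norm_pos_iff.mpr (hay.resolve_left (lt_irrefl 0))
      obtain ⟨C, hC, hWC⟩ := exists_W_le_mul_sq (n := n) (half_pos hy) one_pos
      have hlim : Tendsto (fun τ : ℝ => C * τ ^ 2) (𝓝[≥] 0) (𝓝 0) := by
        have hc : Continuous fun τ : ℝ => C * τ ^ 2 := by fun_prop
        simpa using (hc.tendsto 0).mono_left nhdsWithin_le_nhds
      rw [ContinuousWithinAt, W_of_nonpos le_rfl]
      refine tendsto_of_tendsto_of_tendsto_of_le_of_le' tendsto_const_nhds hlim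
        (.of_forall fun τ => W_nonneg τ y) ?_
      filter_upwards [Icc_mem_nhdsGE one_pos] with τ hτ
      rcases hτ.1.eq_or_lt with rfl | hpos
      · simp [W_of_nonpos]
      · exact hWC (τ, y) (lt_max_of_lt_right (half_lt_self hy)) hpos hτ.2
    · exact (hasDerivAt_W ha y).continuousAt.continuousWithinAt
  have hlim : Tendsto (fun τ => W n τ y * φ τ) atTop (𝓝 0) := by
    refine tendsto_const_nhds.congr' ?_
    filter_upwards [hφ0] with τ hτ
    simp [hτ]
  rw [integral_Ioi_of_hasDerivAt_of_tendsto
    (hcontW.mul (hφ a).continuousAt.continuousWithinAt)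
    (fun τ hτ => (hasDerivAt_W (ha.trans_lt hτ) y).mul (hφ τ)) hint hlim]
  exact zero_sub _

lemma setIntegral_Omega_heatKernelTimeDeriv_mul {ε : ℝ} (hε : 0 < ε) {g g' : ℝ × En n → ℝ}
    (hg : Continuous g) (hgc : HasCompactSupport g) (hg' : Continuous g')
    (hgc' : HasCompactSupport g') (hderiv : ∀ τ y, HasDerivAt (fun σ => g (σ, y)) (g' (τ, y)) τ) :
    ∫ p in Omega n ε, Wt n p.1 p.2 * g p
      = -(∫ p in Omega n ε, W n p.1 p.2 * g' p)
        - ∫ y in closedBall (0 : En n) ε, W n (ε ^ 2) y * g (ε ^ 2, y) := by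
  set D : Set (ℝ × En n) := Omega n ε ∩ {p | 0 < p.1}
  have hDpos : MeasurableSet {p : ℝ × En n | 0 < p.1} :=
    measurableSet_lt measurable_const measurable_fst
  have hD : MeasurableSet D := (isOpen_Omega ε).measurableSet.inter hDpos
  have hrestrict : ∀ F : ℝ × En n → ℝ, (∀ p, p.1 < 0 → F p = 0) →
      ∫ p in Omega n ε, F p = ∫ p in D, F p := by
    intro F hF
    refine setIntegral_eq_of_subset_of_ae_sdiff_eq_zero (f := F) (μ := volume)
      (isOpen_Omega ε).measurableSet.nullMeasurableSet inter_subset_left ?_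
    filter_upwards [ae_fst_ne_zero] with p hp0 hp
    exact hF p (lt_of_le_of_ne (not_lt.mp fun h => hp.2 ⟨hp.1, h⟩) hp0)
  have hint₁ := integrableOn_heatKernelTimeDeriv_mul (n := n) hε hg hgc
  have hint₂ : IntegrableOn (fun p : ℝ × En n => W n p.1 p.2 * g' p) D :=
    (integrable_W_mul hg' hgc').integrableOn
  have hWt : ∫ p in Omega n ε, Wt n p.1 p.2 * g p
      = ∫ p in D, heatKernelTimeDeriv n p.1 p.2 * g p := by
    rw [hrestrict _ fun p hp => by
      rw [Wt_eq_heatKernelTimeDeriv hp.ne, heatKernelTimeDeriv, W_of_nonpos hp.le]; ring]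
    refine setIntegral_congr_fun hD fun p hp => ?_
    have hp0 : 0 < p.1 := hp.2
    simp only [Wt_eq_heatKernelTimeDeriv hp0.ne']
  have hW : ∫ p in Omega n ε, W n p.1 p.2 * g' p = ∫ p in D, W n p.1 p.2 * g' p :=
    hrestrict _ fun p hp => by rw [W_of_nonpos hp.le, zero_mul]
  rw [hWt, hW, eq_sub_iff_add_eq, eq_neg_iff_add_eq_zero, add_right_comm, ← integral_add hint₁ hint₂]
  set F : ℝ × En n → ℝ := fun p => heatKernelTimeDeriv n p.1 p.2 * g p + W n p.1 p.2 * g' p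
  have hF : Integrable (D.indicator F) (volume.prod volume) :=
    (integrable_indicator_iff hD).mpr (hint₁.add hint₂)
  have hslice : ∀ y : En n, (fun τ => D.indicator F (τ, y))
      = (Ioi (if ‖y‖ ≤ ε then ε ^ 2 else 0)).indicator fun τ => F (τ, y) := by
    intro y
    ext τ
    exact indicator_eq_indicator (mem_Omega_and_pos_iff hε τ y) rfl
  have hzero : ∀ y : En n, (fun τ => g (τ, y)) =ᶠ[atTop] 0 := by
    intro y
    obtain ⟨R, hR⟩ := hgc.isCompact.isBounded.subset_closedBall 0
    filter_upwards [eventually_gt_atTop R] with τ hτ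
    refine image_eq_zero_of_notMem_tsupport fun h => ?_
    have hnorm : max ‖τ‖ ‖y‖ ≤ R := mem_closedBall_zero_iff.mp (hR h)
    exact hτ.not_ge ((le_abs_self τ).trans ((le_max_left _ _).trans hnorm))
  have hinner : ∀ᵐ y : En n, ∫ τ, D.indicator F (τ, y)
      = -(closedBall (0 : En n) ε).indicator (fun y => W n (ε ^ 2) y * g (ε ^ 2, y)) y := by
    filter_upwards [hF.prod_left_ae] with y hy
    rw [hslice, integrable_indicator_iff measurableSet_Ioi] at hy
    rw [hslice, integral_indicator measurableSet_Ioi]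
    by_cases hyε : ‖y‖ ≤ ε
    · rw [if_pos hyε] at hy ⊢
      rw [indicator_of_mem (mem_closedBall_zero_iff.mpr hyε)]
      exact integral_Ioi_heatKernel_ibp (by positivity) (.inl (by positivity))
        (fun τ => hderiv τ y) (hzero y) hy
    · rw [if_neg hyε] at hy ⊢
      rw [indicator_of_notMem (by rwa [mem_closedBall_zero_iff])]
      have hy0 : y ≠ 0 := norm_pos_iff.mp (hε.trans (not_le.mp hyε))
      refine (integral_Ioi_heatKernel_ibp le_rfl (.inr hy0)
        (fun τ => hderiv τ y) (hzero y) hy).trans ?_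
      rw [W_of_nonpos le_rfl, zero_mul]
  rw [← integral_indicator hD, Measure.volume_eq_prod, integral_prod_symm _ hF,
    integral_congr_ae hinner, integral_neg, integral_indicator measurableSet_closedBall,
    neg_add_cancel]

/-- for `f` bounded, `C²`, compactly supported, and
`u(t,x) = ∫₀^∞ ∫_{ℝⁿ} W(τ,y) f(t-τ,x-y) dy dτ`, the time derivative of `u` is given by a
principal value:
`∂_t u(t,x) = lim_{ε→0} ∬_{Ω_ε} ∂_τ W(τ,y) f(t-τ,x-y) dy dτ + B_n f(t,x)`,
i.e. the truncated integrals converge to `∂_t u(t,x) − B_n f(t,x)` as `ε → 0⁺`. -/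
theorem heat_global_time_derivative_formula (n : ℕ) (hn : 1 ≤ n)
    (f : ℝ × En n → ℝ) (hfb : ∃ M, ∀ z, |f z| ≤ M) (hf2 : ContDiff ℝ 2 f)
    (hfc : HasCompactSupport f) (t : ℝ) (x : En n) :
    Tendsto
      (fun ε : ℝ => ∫ p in Omega n ε, Wt n p.1 p.2 * f (t - p.1, x - p.2))
      (𝓝[>] 0)
      (𝓝 (deriv (fun s : ℝ => ∫ p : ℝ × En n, W n p.1 p.2 * f (s - p.1, x - p.2)) t
          - Bn n * f (t, x))) := by
  obtain ⟨M, hM⟩ := hfb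
  set φ : ℝ × En n ≃ₜ ℝ × En n := Homeomorph.subLeft (t, x)
  set f' : ℝ × En n → ℝ := fun z => fderiv ℝ f z (1, 0)
  have hf' : Continuous f' :=
    (hf2.continuous_fderiv two_ne_zero).clm_apply continuous_const
  have hfc' : HasCompactSupport f' := hfc.fderiv_apply ℝ _
  have hgc : HasCompactSupport (f ∘ φ) := hfc.comp_homeomorph φ
  have hgc' : HasCompactSupport (fun p => -f' (φ p)) := (hfc'.comp_homeomorph φ).neg
  have hg : Continuous (f ∘ φ) := hf2.continuous.comp φ.continuous
  have hg' : Continuous (fun p => -f' (φ p)) := (hf'.comp φ.continuous).neg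
  have hderiv : ∀ τ y, HasDerivAt (fun σ => (f ∘ φ) (σ, y)) (-f' (φ (τ, y))) τ := by
    intro τ y
    have hline : HasDerivAt (fun σ : ℝ => (t - σ, x - y)) (-((1 : ℝ), (0 : En n))) τ := by
      rw [Prod.neg_mk, neg_zero]
      exact ((hasDerivAt_id τ).const_sub t).prodMk (hasDerivAt_const τ (x - y))
    have hfd := (hf2.differentiable two_ne_zero (t - τ, x - y)).hasFDerivAt
    exact (hfd.comp_hasDerivAt τ hline).congr_deriv (map_neg _ _)
  have hpot := tendsto_setIntegral_Omega (integrable_W_mul hg' hgc')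
  have hbdry := tendsto_integral_closedBall_W hn hg (M := M) fun p => hM (φ p)
  have hφ0 : (f ∘ φ) 0 = f (t, x) := congrArg f (sub_zero (t, x))
  rw [hφ0] at hbdry
  have hu : -(∫ p : ℝ × En n, W n p.1 p.2 * -f' (φ p))
      = deriv (fun s : ℝ => ∫ p : ℝ × En n, W n p.1 p.2 * f (s - p.1, x - p.2)) t := by
    rw [deriv_heat_potential (hf2.of_le one_le_two) hfc, ← integral_neg]
    simp_rw [mul_neg, neg_neg]
    rfl
  rw [← hu]
  refine (hpot.neg.sub hbdry).congr' ?_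
  filter_upwards [self_mem_nhdsWithin] with ε hε
  exact (setIntegral_Omega_heatKernelTimeDeriv_mul hε hg hgc hg' hgc' hderiv).symm
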